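/- For every k ∈ ℕ, the k-th Grassmann power Ω^k(V) of the natural gl(m|n)-module V = F^{m|n} is an irreducible gl(m|n)-module. Moreover Ω^k(V) ≅ L⁰(Λ), where Λ = ε₁+⋯+ε_k if k ≤ m, and Λ = ε₁+⋯+ε_m + (k−m)δ₁ if k ≥ m. -/

import Mathlib

noncomputable section
open Classical

namespace Wmn

/-! ## Monomial combinatorics for `R = F[x₁,…,x_m] ⊗ Λ(y₁,…,y_n)`.
A monomial `x^α y_η` is encoded as a pair `(α, η)`. -/

/-- Index of the monomial basis `x^α y_η` of `R`. -/
abbrev Mon (m n : ℕ) : Type := (Fin m → ℕ) × Finset (Fin n)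

/-- Index of the standard basis `x^α y_η ∂_i`, `x^α y_η D_j` of `W(m,n)`. -/
abbrev Bix (m n : ℕ) : Type := Mon m n × (Fin m ⊕ Fin n)

/-- degree of a monomial -/
def mdeg {m n : ℕ} (a : Mon m n) : ℕ := (∑ i, a.1 i) + a.2.card

/-- parity (as a natural number, to be used in exponents of `-1`) of a monomial -/
def mpar {m n : ℕ} (a : Mon m n) : ℕ := a.2.card

/-- ℤ-degree of a basis element of `W(m,n)` -/
def bdeg {m n : ℕ} (u : Bix m n) : ℤ := (mdeg u.1 : ℤ) - 1

/-- parity of a basis element of `W(m,n)` -/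
def bpar {m n : ℕ} (u : Bix m n) : ℕ :=
  match u.2 with
  | Sum.inl _ => mpar u.1
  | Sum.inr _ => mpar u.1 + 1

/-- The Koszul sign obtained when multiplying `y_η · y_μ` (zero if they overlap). -/
def ysgn {n : ℕ} (η μ : Finset (Fin n)) : ℤ :=
  if Disjoint η μ then (-1 : ℤ) ^ (((η ×ˢ μ).filter fun p => p.2 < p.1).card) else 0

/-- product of two monomials: coefficient and resulting monomial -/
def mprod {m n : ℕ} (a b : Mon m n) : ℤ × Mon m n :=
  (ysgn a.2 b.2, (a.1 + b.1, a.2 ∪ b.2))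

/-- decrement the `i`-th exponent -/
def xdec {m : ℕ} (i : Fin m) (α : Fin m → ℕ) : Fin m → ℕ := Function.update α i (α i - 1)

/-- `∂_i` applied to a monomial: coefficient and resulting monomial. -/
def dxa {m n : ℕ} (i : Fin m) (a : Mon m n) : ℤ × Mon m n :=
  ((a.1 i : ℤ), (xdec i a.1, a.2))

/-- sign of `D_j (y_η)` -/
def dyc {n : ℕ} (j : Fin n) (η : Finset (Fin n)) : ℤ :=
  if j ∈ η then (-1 : ℤ) ^ ((η.filter fun c => c < j).card) else 0

/-- `D_j` applied to a monomial: coefficient and resulting monomial. -/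
def dya {m n : ℕ} (j : Fin n) (a : Mon m n) : ℤ × Mon m n :=
  (dyc j a.2, (a.1, a.2.erase j))

/-- the monomial `x_i` -/
def xmon {m n : ℕ} (i : Fin m) : Mon m n := (Pi.single i 1, ∅)

/-- the monomial `y_j` -/
def ymon {m n : ℕ} (j : Fin n) : Mon m n := (0, {j})

/-- the monomial `1` -/
def onemon {m n : ℕ} : Mon m n := (0, ∅)

/-- `a · ∂_i(b)`, as coefficient and monomial. -/
def mulX {m n : ℕ} (a b : Mon m n) (i : Fin m) : ℤ × Mon m n :=
  ((dxa i b).1 * (mprod a (dxa i b).2).1, (mprod a (dxa i b).2).2)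

/-- `a · D_j(b)`, as coefficient and monomial. -/
def mulY {m n : ℕ} (a b : Mon m n) (j : Fin n) : ℤ × Mon m n :=
  ((dya j b).1 * (mprod a (dya j b).2).1, (mprod a (dya j b).2).2)

/-- parity of the index `a` in `gl(m|n)` : `0` if `a < m`, `1` otherwise -/
def gp (m : ℕ) {k : ℕ} (a : Fin k) : ℕ := if (a : ℕ) < m then 0 else 1

end Wmn

namespace Wmn

/-! ## Weights for `gl(m|n)`:  `h* = Σ F εᵢ ⊕ Σ F δⱼ` in coordinates. -/

/-- The space `h*` of weights, in the coordinates of the basis `ε₁,…,ε_m,δ₁,…,δ_n`. -/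
abbrev Wt (F : Type) (m n : ℕ) : Type := (Fin m → F) × (Fin n → F)

variable {F : Type} [Field F] {m n : ℕ}

/-- `ε_i` (0-based index) -/
def epsw (i : Fin m) : Wt F m n := (Pi.single i 1, 0)

/-- `δ_j` (0-based index) -/
def delw (j : Fin n) : Wt F m n := (0, Pi.single j 1)

/-- `ε_i` with 1-based natural index (zero if out of range) -/
def eps1 (i : ℕ) : Wt F m n := (fun t => if (t : ℕ) + 1 = i then 1 else 0, 0)

/-- `δ_j` with 1-based natural index (zero if out of range) -/
def del1 (j : ℕ) : Wt F m n := (0, fun t => if (t : ℕ) + 1 = j then 1 else 0)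

/-- the `a`-th coordinate of a weight, `a : Fin (m+n)` -/
def coordw (w : Wt F m n) (a : Fin (m + n)) : F :=
  if h : (a : ℕ) < m then w.1 ⟨a, h⟩ else w.2 ⟨(a : ℕ) - m, by have := a.isLt; omega⟩

/-- dominant integral weights (`Λ⁺`) -/
def IsDominant (w : Wt F m n) : Prop :=
  (∀ i j : Fin m, i ≤ j → ∃ k : ℕ, w.1 i - w.1 j = (k : F)) ∧
  (∀ i j : Fin n, i ≤ j → ∃ k : ℕ, w.2 i - w.2 j = (k : F))

/-- weight of the monomial `x^α y_η` -/
def monWt (a : Mon m n) : Wt F m n :=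
  (fun i => (a.1 i : F), fun j => if j ∈ a.2 then 1 else 0)

/-- `E = Σ εᵢ − Σ δⱼ` -/
def calE (F : Type) [Field F] (m n : ℕ) : Wt F m n := (fun _ => 1, fun _ => -1)

/-- the exceptional weights `ω_k` of type I -/
def omegaw (F : Type) [Field F] (m n : ℕ) (k : ℕ) : Wt F m n :=
  (∑ i ∈ Finset.range (min k m), (eps1 (i + 1) : Wt F m n)) + ((k - m : ℕ) : F) • (del1 1 : Wt F m n)

/-- the exceptional weights `θ_q` of type II -/
def thetaw (F : Type) [Field F] (m n : ℕ) (q : ℕ) : Wt F m n :=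
  ((∑ i ∈ Finset.range m, (eps1 (i + 1) : Wt F m n)) - ∑ j ∈ Finset.range n, (del1 (j + 1) : Wt F m n))
    - (q : F) • (del1 n : Wt F m n)

/-- exceptional weights -/
def ExcWt (F : Type) [Field F] (m n : ℕ) (w : Wt F m n) : Prop :=
  (∃ k : ℕ, w = omegaw F m n k) ∨ (∃ q : ℕ, w = thetaw F m n q)

/-- the longest Weyl group element `w∘` acting on weights -/
def wflip (w : Wt F m n) : Wt F m n := (fun i => w.1 i.rev, fun j => w.2 j.rev)

end Wmn

namespace Wmn

/-! ## Data of a `gl(m|n)`-module: actions of the matrix units `E_{ab}` -/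

structure GlRep (F : Type) [Field F] (m n : ℕ) where
  M : Type
  [acg : AddCommGroup M]
  [mod : Module F M]
  /-- action of the matrix unit `E_{ab}` -/
  E : Fin (m + n) → Fin (m + n) → M →ₗ[F] M

attribute [instance] GlRep.acg GlRep.mod

variable {F : Type} [Field F] {m n : ℕ}

/-- The relations making the data `W.E` an honest representation of the Lie
superalgebra `gl(m|n)`:
`[E_{ab}, E_{cd}] = δ_{bc} E_{ad} − (−1)^{p(E_{ab})p(E_{cd})} δ_{da} E_{cb}`
(super commutator). -/
def IsGlRep (W : GlRep F m n) : Prop :=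
  ∀ a b c d : Fin (m + n),
    W.E a b ∘ₗ W.E c d
        - ((-1 : F) ^ ((gp m a + gp m b) * (gp m c + gp m d))) • (W.E c d ∘ₗ W.E a b)
      = (if b = c then W.E a d else 0)
        - ((-1 : F) ^ ((gp m a + gp m b) * (gp m c + gp m d))) • (if d = a then W.E c b else 0)

/-- `v` is a weight vector of weight `w` -/
def glWtVec (W : GlRep F m n) (w : Wt F m n) (v : W.M) : Prop :=
  ∀ a : Fin (m + n), W.E a a v = coordw w a • v

/-- `v` is annihilated by the raising operators of the standard Borel -/
def glRaise (W : GlRep F m n) (v : W.M) : Prop :=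
  ∀ a b : Fin (m + n), a < b → W.E a b v = 0

/-- a `gl(m|n)`-stable subspace -/
def glStable (W : GlRep F m n) (N : Submodule F W.M) : Prop :=
  ∀ a b : Fin (m + n), ∀ x ∈ N, W.E a b x ∈ N

/-- simplicity of a `gl(m|n)`-module -/
def glSimple (W : GlRep F m n) : Prop :=
  (∃ v : W.M, v ≠ 0) ∧ ∀ N : Submodule F W.M, glStable W N → N = ⊥ ∨ N = ⊤

/-- `W` is a finite-dimensional irreducible `gl(m|n)`-module of highest weight `w`
(this characterizes `L⁰(w)` up to isomorphism). -/
def IsIrrHW (W : GlRep F m n) (w : Wt F m n) : Prop :=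
  IsGlRep W ∧ glSimple W ∧ FiniteDimensional F W.M ∧
    ∃ v : W.M, v ≠ 0 ∧ glWtVec W w v ∧ glRaise W v

/-- weight space of a `gl(m|n)`-module -/
def glWtSp (W : GlRep F m n) (w : Wt F m n) : Submodule F W.M :=
  ⨅ a : Fin (m + n), Module.End.eigenspace (W.E a a) (coordw w a)

/-- formal character of a (finite-dimensional) `gl(m|n)`-module -/
def chGl (W : GlRep F m n) : Wt F m n → ℤ :=
  fun w => (Module.finrank F (glWtSp W w) : ℤ)

end Wmn

namespace Wmn

variable {F : Type} [Field F] {m n : ℕ}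

/-! ## The Grassmann algebra `Ω(V)` of the natural module `V = F^{m|n}` and its
`gl(m|n)`-action by superderivations.  A basis monomial
`e_{i₁}∧⋯∧e_{i_r} ∧ e_{m+j}^{f j}` is encoded as a pair `(I, f)` with
`I : Finset (Fin m)` (even generators, which anticommute) and `f : Fin n → ℕ`
(odd generators, which commute among themselves). -/

/-- Index of the monomial basis of `Ω(V)`. -/
abbrev GIx (m n : ℕ) : Type := Finset (Fin m) × (Fin n → ℕ)

/-- degree of a Grassmann monomial -/
def gdeg {m n : ℕ} (p : GIx m n) : ℕ := p.1.card + ∑ j, p.2 j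

/-- Action of the matrix unit `E_{ab}` on a Grassmann basis monomial, as a
coefficient together with the resulting monomial (derivation with Koszul signs). -/
def eact (m n : ℕ) (a b : Fin (m + n)) (p : GIx m n) : ℤ × GIx m n :=
  if ha : (a : ℕ) < m then
    if hb : (b : ℕ) < m then
      have a' : Fin m := ⟨a, ha⟩
      have b' : Fin m := ⟨b, hb⟩
      if b' ∈ p.1 then
        if a' = b' then (1, p)
        else if a' ∈ p.1 then (0, p)
        else (((-1 : ℤ) ^ ((p.1.filter fun c => min a' b' < c ∧ c < max a' b').card)),
          (insert a' (p.1.erase b'), p.2))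
      else (0, p)
    else
      have a' : Fin m := ⟨a, ha⟩
      have b' : Fin n := ⟨(b : ℕ) - m, by have := b.isLt; omega⟩
      ((p.2 b' : ℤ) *
          (if a' ∈ p.1 then 0 else (-1 : ℤ) ^ ((p.1.filter fun c => a' < c).card)),
        (insert a' p.1, Function.update p.2 b' (p.2 b' - 1)))
  else
    if hb : (b : ℕ) < m then
      have a' : Fin n := ⟨(a : ℕ) - m, by have := a.isLt; omega⟩
      have b' : Fin m := ⟨b, hb⟩
      ((if b' ∈ p.1 then (-1 : ℤ) ^ ((p.1.filter fun c => b' < c).card) else 0),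
        (p.1.erase b', Function.update p.2 a' (p.2 a' + 1)))
    else
      have a' : Fin n := ⟨(a : ℕ) - m, by have := a.isLt; omega⟩
      have b' : Fin n := ⟨(b : ℕ) - m, by have := b.isLt; omega⟩
      ((p.2 b' : ℤ),
        (p.1, Function.update (Function.update p.2 b' (p.2 b' - 1)) a'
          ((Function.update p.2 b' (p.2 b' - 1)) a' + 1)))

/-- The Grassmann algebra `Ω(V)` of the natural module as a `gl(m|n)`-module. -/
def OmegaGl (F : Type) [Field F] (m n : ℕ) : GlRep F m n where
  M := GIx m n →₀ F
  E := fun a b => Finsupp.lsum F fun p : GIx m n =>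
    (((eact m n a b p).1 : F) • (Finsupp.lsingle (eact m n a b p).2 : F →ₗ[F] GIx m n →₀ F))

/-- the `k`-th Grassmann power `Ω^k(V)` as a subspace of `Ω(V)` -/
def OmegaK (F : Type) [Field F] (m n k : ℕ) : Submodule F (GIx m n →₀ F) :=
  Submodule.span F {x | ∃ p : GIx m n, gdeg p = k ∧ x = Finsupp.single p (1 : F)}

/-- wedging on the right with `e_i` (even): coefficient and index -/
def wedgeX {m n : ℕ} (i : Fin m) (p : GIx m n) : ℤ × GIx m n :=
  ((if i ∈ p.1 then 0
      else (-1 : ℤ) ^ ((∑ j, p.2 j) + (p.1.filter fun c => i < c).card)),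
    (insert i p.1, p.2))

/-- wedging on the right with `e_{m+j}` (odd): coefficient and index -/
def wedgeY {m n : ℕ} (j : Fin n) (p : GIx m n) : ℤ × GIx m n :=
  (1, (p.1, Function.update p.2 j (p.2 j + 1)))

/-- The differential `𝔡` of the type-I complex, defined on all of
`R ⊗ Ω(V) = ⊕_k V(ω_k)` by
`x^α y_η ⊗ w ↦ Σᵢ ∂ᵢ(x^α) y_η ⊗ (w ∧ eᵢ) + (−1)^{p(w)+|η|+1} Σⱼ x^α Dⱼ(y_η) ⊗ (w ∧ e_{m+j})`. -/
def dOm (F : Type) [Field F] (m n : ℕ) :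
    (Mon m n →₀ (GIx m n →₀ F)) →ₗ[F] (Mon m n →₀ (GIx m n →₀ F)) :=
  Finsupp.lsum F fun a : Mon m n => Finsupp.lsum F fun p : GIx m n =>
    LinearMap.toSpanSingleton F (Mon m n →₀ (GIx m n →₀ F))
      ((∑ i : Fin m, (((dxa i a).1 * (wedgeX i p).1 : ℤ) : F) •
          Finsupp.single ((dxa i a).2 : Mon m n) (Finsupp.single (wedgeX i p).2 (1 : F)))
        + (-1 : F) ^ ((∑ j, p.2 j) + mpar a + 1) •
          ∑ j : Fin n, (((dya j a).1 * (wedgeY j p).1 : ℤ) : F) •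
            Finsupp.single ((dya j a).2 : Mon m n) (Finsupp.single (wedgeY j p).2 (1 : F)))

/-- the subspace `V(ω_k) = R ⊗ Ω^k(V)` of `R ⊗ Ω(V)` -/
def WOm (F : Type) [Field F] (m n k : ℕ) : Submodule F (Mon m n →₀ (GIx m n →₀ F)) :=
  Submodule.span F {x | ∃ (a : Mon m n) (p : GIx m n), gdeg p = k ∧
    x = Finsupp.single a (Finsupp.single p (1 : F))}

end Wmn

open Wmn

namespace Wmn

/-! ## Creation and annihilation operators on `Ω(V)` -/

/-- The sign `(-1)^#{c ∈ I | i < c}`. -/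
def rsgn {m : ℕ} (i : Fin m) (I : Finset (Fin m)) : ℤ :=
  (-1 : ℤ) ^ ((I.filter fun c => i < c).card)

theorem rsgn_mul_self {m : ℕ} (i : Fin m) (I : Finset (Fin m)) : rsgn i I * rsgn i I = 1 := by
  simp [rsgn, ← mul_pow]

theorem rsgn_ne_zero {m : ℕ} (i : Fin m) (I : Finset (Fin m)) : rsgn i I ≠ 0 := by
  simp [rsgn]

theorem rsgn_insert {m : ℕ} (i j : Fin m) (I : Finset (Fin m)) (hj : j ∉ I) :
    rsgn i (insert j I) = (if i < j then -1 else 1) * rsgn i I := by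
  unfold rsgn
  rw [Finset.filter_insert]
  split_ifs with h
  · rw [Finset.card_insert_of_notMem (by simp [hj]), pow_succ]; ring
  · simp

theorem rsgn_erase {m : ℕ} (i j : Fin m) (I : Finset (Fin m)) (hj : j ∈ I) :
    rsgn i (I.erase j) = (if i < j then -1 else 1) * rsgn i I := by
  have h := rsgn_insert i j (I.erase j) (Finset.notMem_erase j I)
  rw [Finset.insert_erase hj] at h
  rw [h]
  split_ifs <;> simp

theorem rsgn_mul_rsgn_erase {m : ℕ} (a b : Fin m) (I : Finset (Fin m)) (hb : b ∈ I)
    (ha : a ∉ I) :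
    rsgn b I * rsgn a (I.erase b)
      = (-1 : ℤ) ^ ((I.filter fun c => min a b < c ∧ c < max a b).card) := by
  have split : ∀ (u v : Fin m), u < v →
      (I.filter fun c => u < c).card = ((I.filter fun c => u < c ∧ c < v).card
        + (I.filter fun c => v < c).card) + (if v ∈ I then 1 else 0) := by
    intro u v huv
    have h : (I.filter fun c => u < c) = ((I.filter fun c => u < c ∧ c < v)
        ∪ (I.filter fun c => v < c)) ∪ (I.filter fun c => c = v) := by
      ext c
      simp only [Finset.mem_filter, Finset.mem_union]
      grind
    rw [h, Finset.card_union_of_disjoint, Finset.card_union_of_disjoint, Finset.filter_eq' I v]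
    · split_ifs <;> simp
    · rw [Finset.disjoint_left]; grind
    · rw [Finset.disjoint_left]; grind
  have hab : a ≠ b := by rintro rfl; exact ha hb
  rw [rsgn_erase _ _ _ hb]
  unfold rsgn
  rcases lt_or_gt_of_ne hab with h | h
  · rw [split a b h, min_eq_left h.le, max_eq_right h.le, if_pos h, if_pos hb, pow_succ, pow_add]
    have := rsgn_mul_self b I
    unfold rsgn at this
    linear_combination (-1 : ℤ) ^ ((I.filter fun c => a < c ∧ c < b).card) * this
  · rw [split b a h, min_eq_right h.le, max_eq_left h.le, if_neg h.not_gt, if_neg ha, add_zero,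
      pow_add]
    have := rsgn_mul_self a I
    unfold rsgn at this
    linear_combination (-1 : ℤ) ^ ((I.filter fun c => b < c ∧ c < a).card) * this

section
variable {m n : ℕ}

/-- Right multiplication by a generator of `Ω(V)` on monomials, normalized so that even and odd
generators commute. -/
def cre (x : Fin m ⊕ Fin n) (p : GIx m n) : ℤ × GIx m n :=
  match x with
  | Sum.inl i => (if i ∈ p.1 then 0 else rsgn i p.1, (insert i p.1, p.2))
  | Sum.inr j => (1, (p.1, Function.update p.2 j (p.2 j + 1)))

/-- Differentiation with respect to a generator of `Ω(V)` on monomials, with the normalization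
of `cre`. -/
def ann (x : Fin m ⊕ Fin n) (p : GIx m n) : ℤ × GIx m n :=
  match x with
  | Sum.inl i => (if i ∈ p.1 then rsgn i p.1 else 0, (p.1.erase i, p.2))
  | Sum.inr j => ((p.2 j : ℤ), (p.1, Function.update p.2 j (p.2 j - 1)))

/-- The sign governing the exchange of two generators in the normalization of `cre`. -/
def exsgn (F : Type) [Field F] (x y : Fin m ⊕ Fin n) : F :=
  match x, y with
  | Sum.inl _, Sum.inl _ => -1
  | _, _ => 1

variable (F : Type) [Field F]

/-- The linear operator on `Ω(V)` sending each monomial to a multiple of a monomial. -/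
def monOp (g : GIx m n → ℤ × GIx m n) : (GIx m n →₀ F) →ₗ[F] (GIx m n →₀ F) :=
  Finsupp.lsum F fun p : GIx m n =>
    (((g p).1 : F) • (Finsupp.lsingle (g p).2 : F →ₗ[F] GIx m n →₀ F))

variable {F}

theorem monOp_single (g : GIx m n → ℤ × GIx m n) (p : GIx m n) (c : F) :
    monOp F g (Finsupp.single p c) = Finsupp.single (g p).2 (((g p).1 : F) * c) := by
  simp [monOp]

theorem cre_cre (x y : Fin m ⊕ Fin n) :
    monOp F (cre x) ∘ₗ monOp F (cre y)
      = exsgn F x y • (monOp F (cre y) ∘ₗ monOp F (cre x)) := by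
  refine Finsupp.lhom_ext fun p c => ?_
  simp only [LinearMap.comp_apply, LinearMap.smul_apply, monOp_single, Finsupp.smul_single,
    smul_eq_mul]
  rcases x with i | i <;> rcases y with j | j
  · by_cases hij : i = j
    · subst hij; simp [cre]
    by_cases hi : i ∈ p.1
    · simp [cre, hi]
    by_cases hj : j ∈ p.1
    · simp [cre, hj]
    simp only [cre, exsgn, Finset.mem_insert, hi, hj, hij, Ne.symm hij, or_false, if_false,
      rsgn_insert _ _ _ hi, rsgn_insert _ _ _ hj, Finset.insert_comm i j]
    congr 1
    rcases lt_or_gt_of_ne hij with h | h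
    · simp only [h, h.not_gt, if_true, if_false]; push_cast; ring
    · simp only [h, h.not_gt, if_true, if_false]; push_cast; ring
  · by_cases hi : i ∈ p.1 <;> simp [cre, exsgn, hi]
  · by_cases hj : j ∈ p.1 <;> simp [cre, exsgn, hj]
  · simp only [cre, exsgn]
    by_cases hij : i = j
    · subst hij; simp
    · simp [Function.update_of_ne hij, Function.update_of_ne (Ne.symm hij),
        Function.update_comm hij]

theorem ann_ann (x y : Fin m ⊕ Fin n) :
    monOp F (ann x) ∘ₗ monOp F (ann y)
      = exsgn F x y • (monOp F (ann y) ∘ₗ monOp F (ann x)) := by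
  refine Finsupp.lhom_ext fun p c => ?_
  simp only [LinearMap.comp_apply, LinearMap.smul_apply, monOp_single, Finsupp.smul_single,
    smul_eq_mul]
  rcases x with i | i <;> rcases y with j | j
  · by_cases hij : i = j
    · subst hij; simp [ann]
    by_cases hi : i ∈ p.1
    swap
    · simp [ann, hi]
    by_cases hj : j ∈ p.1
    swap
    · simp [ann, hj]
    simp only [ann, exsgn, Finset.mem_erase, hi, hj, hij, Ne.symm hij, if_true, ne_eq,
      not_false_eq_true, and_self,
      rsgn_erase _ _ _ hi, rsgn_erase _ _ _ hj, Finset.erase_right_comm (a := i) (b := j)]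
    congr 1
    rcases lt_or_gt_of_ne hij with h | h
    · simp only [h, h.not_gt, if_true, if_false]; push_cast; ring
    · simp only [h, h.not_gt, if_true, if_false]; push_cast; ring
  · by_cases hi : i ∈ p.1 <;> simp [ann, exsgn, hi, mul_left_comm]
  · by_cases hj : j ∈ p.1 <;> simp [ann, exsgn, hj, mul_left_comm]
  · simp only [ann, exsgn]
    by_cases hij : i = j
    · subst hij; simp
    · simp [Function.update_of_ne hij, Function.update_of_ne (Ne.symm hij),
        Function.update_comm hij, mul_left_comm]

theorem ann_cre (x y : Fin m ⊕ Fin n) :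
    monOp F (ann x) ∘ₗ monOp F (cre y)
      = (if x = y then LinearMap.id else 0)
        + exsgn F x y • (monOp F (cre y) ∘ₗ monOp F (ann x)) := by
  refine Finsupp.lhom_ext fun p c => ?_
  simp only [LinearMap.comp_apply, LinearMap.smul_apply, LinearMap.add_apply, monOp_single,
    Finsupp.smul_single, smul_eq_mul]
  rcases x with i | i <;> rcases y with j | j
  · by_cases hij : i = j
    · subst hij
      have h2 : (rsgn i p.1 : F) * rsgn i p.1 = 1 := by
        rw [← Int.cast_mul, rsgn_mul_self, Int.cast_one]
      by_cases hi : i ∈ p.1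
      · simp [ann, cre, exsgn, hi, rsgn_erase, ← mul_assoc, h2]
      · simp [ann, cre, exsgn, hi, rsgn_insert, ← mul_assoc, h2]
    by_cases hi : i ∈ p.1
    swap
    · simp [ann, cre, hi, hij]
    by_cases hj : j ∈ p.1
    · simp [ann, cre, hj, hij, Ne.symm hij]
    simp only [ann, cre, exsgn, Finset.mem_erase, Finset.mem_insert, hi, hj, hij,
      if_true, if_false, or_true, and_false, Sum.inl.injEq, LinearMap.zero_apply, zero_add,
      rsgn_erase _ _ _ hi, rsgn_insert _ _ _ hj, Finset.erase_insert_of_ne (Ne.symm hij)]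
    congr 1
    rcases lt_or_gt_of_ne hij with h | h
    · simp only [h, h.not_gt, if_true, if_false]; push_cast; ring
    · simp only [h, h.not_gt, if_true, if_false]; push_cast; ring
  · by_cases hi : i ∈ p.1 <;> simp [ann, cre, exsgn, hi]
  · by_cases hj : j ∈ p.1 <;> simp [ann, cre, exsgn, hj, mul_left_comm]
  · simp only [ann, cre, exsgn]
    by_cases hij : i = j
    · subst hij
      rcases Nat.eq_zero_or_pos (p.2 i) with h | h
      · have : Function.update p.2 i 0 = p.2 := by rw [← h]; simp
        simp [h, this]
      · have : p.2 i - 1 + 1 = p.2 i := by omega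
        simp [this, ← Finsupp.single_add, -Finsupp.single_mul]
        congr 1
        ring
    · simp [Function.update_of_ne (Ne.symm hij), hij,
        Function.update_comm hij]

/-- The index in `Fin (m + n)` of a basis vector of `V`. -/
def vidx (x : Fin m ⊕ Fin n) : Fin (m + n) := finSumFinEquiv x

theorem vidx_surjective (a : Fin (m + n)) : ∃ x : Fin m ⊕ Fin n, vidx x = a :=
  finSumFinEquiv.surjective a

theorem vidx_inj {x y : Fin m ⊕ Fin n} : vidx x = vidx y ↔ x = y :=
  finSumFinEquiv.injective.eq_iff

theorem monOp_eact (x y : Fin m ⊕ Fin n) :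
    monOp F (eact m n (vidx x) (vidx y)) = monOp F (cre x) ∘ₗ monOp F (ann y) := by
  refine Finsupp.lhom_ext fun p c => ?_
  simp only [LinearMap.comp_apply, monOp_single]
  rcases x with i | i <;> rcases y with j | j
  · by_cases hj : j ∈ p.1
    swap
    · simp [eact, vidx, cre, ann, hj]
    by_cases hij : i = j
    · subst hij
      have h2 : (rsgn i p.1 : F) * rsgn i p.1 = 1 := by
        rw [← Int.cast_mul, rsgn_mul_self, Int.cast_one]
      simp [eact, vidx, cre, ann, hj, rsgn_erase, ← mul_assoc, h2]
    by_cases hi : i ∈ p.1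
    · simp [eact, vidx, cre, ann, hj, hi, hij]
    · have h := rsgn_mul_rsgn_erase i j p.1 hj hi
      have he : eact m n (vidx (Sum.inl i)) (vidx (Sum.inl j)) p
          = (rsgn j p.1 * rsgn i (p.1.erase j), (insert i (p.1.erase j), p.2)) := by
        rw [h]
        simp [eact, vidx, hj, hi, hij]
      rw [he]
      simp only [cre, ann, hj, hi, if_true, if_false, Finset.mem_erase, and_false]
      congr 1
      push_cast; ring
  · by_cases hi : i ∈ p.1
    · simp [eact, vidx, cre, ann, hi]
    · simp [eact, vidx, cre, ann, rsgn, hi, mul_comm, mul_left_comm, -Finsupp.single_mul]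
      congr!
  · by_cases hj : j ∈ p.1
    · simp [eact, vidx, cre, ann, rsgn, hj, -Finsupp.single_mul]
      congr!
    · simp [eact, vidx, ann, hj]
  · simp [eact, vidx, cre, ann]

theorem exsgn_comm (x y : Fin m ⊕ Fin n) : exsgn F x y = exsgn F y x := by
  rcases x with _ | _ <;> rcases y with _ | _ <;> rfl

theorem exsgn_mul_self (x y : Fin m ⊕ Fin n) : exsgn F x y * exsgn F x y = 1 := by
  rcases x with _ | _ <;> rcases y with _ | _ <;> simp [exsgn]

theorem neg_one_pow_gp (x y z t : Fin m ⊕ Fin n) :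
    (-1 : F) ^ ((gp m (vidx x) + gp m (vidx y)) * (gp m (vidx z) + gp m (vidx t)))
      = exsgn F x z * exsgn F x t * exsgn F y z * exsgn F y t := by
  rcases x with _ | _ <;> rcases y with _ | _ <;> rcases z with _ | _ <;> rcases t with _ | _ <;>
    norm_num [exsgn, gp, vidx]

theorem isGlRep_omegaGl : IsGlRep (OmegaGl F m n) := by
  intro a b c d
  obtain ⟨x, rfl⟩ := vidx_surjective a
  obtain ⟨y, rfl⟩ := vidx_surjective b
  obtain ⟨z, rfl⟩ := vidx_surjective c
  obtain ⟨t, rfl⟩ := vidx_surjective d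
  rw [neg_one_pow_gp]
  simp only [vidx_inj]
  set s : F := exsgn F x z * exsgn F x t * exsgn F y z * exsgn F y t with hs
  change monOp F (eact m n (vidx x) (vidx y)) ∘ₗ monOp F (eact m n (vidx z) (vidx t))
      - s • (monOp F (eact m n (vidx z) (vidx t)) ∘ₗ monOp F (eact m n (vidx x) (vidx y)))
    = (if y = z then monOp F (eact m n (vidx x) (vidx t)) else 0)
      - s • (if t = x then monOp F (eact m n (vidx z) (vidx y)) else 0)
  simp only [monOp_eact]
  refine LinearMap.ext fun v => ?_
  have e1 : monOp F (ann y) (monOp F (cre z) (monOp F (ann t) v))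
      = (if y = z then monOp F (ann t) v else 0)
        + exsgn F y z • monOp F (cre z) (monOp F (ann y) (monOp F (ann t) v)) := by
    have := LinearMap.congr_fun (ann_cre (F := F) y z) (monOp F (ann t) v)
    split_ifs at this ⊢ <;> simpa using this
  have e2 : monOp F (ann t) (monOp F (cre x) (monOp F (ann y) v))
      = (if t = x then monOp F (ann y) v else 0)
        + exsgn F t x • monOp F (cre x) (monOp F (ann t) (monOp F (ann y) v)) := by
    have := LinearMap.congr_fun (ann_cre (F := F) t x) (monOp F (ann y) v)
    split_ifs at this ⊢ <;> simpa using this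
  have e3 : monOp F (ann y) (monOp F (ann t) v)
      = exsgn F y t • monOp F (ann t) (monOp F (ann y) v) :=
    LinearMap.congr_fun (ann_ann (F := F) y t) v
  have e4 : ∀ u, monOp F (cre x) (monOp F (cre z) u)
      = exsgn F x z • monOp F (cre z) (monOp F (cre x) u) :=
    LinearMap.congr_fun (cre_cre (F := F) x z)
  simp only [LinearMap.sub_apply, LinearMap.smul_apply, LinearMap.comp_apply, e1, e2, e3,
    map_add, map_smul, e4, smul_add, smul_smul, exsgn_comm t x]
  have h1 := exsgn_mul_self (F := F) x t
  have h2 : s * exsgn F x t = exsgn F y z * exsgn F y t * exsgn F x z := by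
    linear_combination exsgn F x z * exsgn F y z * exsgn F y t * h1
  rw [h2]
  split_ifs <;> simp


/-! ## Multiplicities and irreducibility -/

/-- The multiplicity of a basis vector of `V` in a Grassmann monomial. -/
def mult (p : GIx m n) : Fin m ⊕ Fin n → ℕ :=
  Sum.elim (fun i => if i ∈ p.1 then 1 else 0) p.2

theorem mult_injective : Function.Injective (mult : GIx m n → Fin m ⊕ Fin n → ℕ) := by
  intro p q h
  refine Prod.ext (Finset.ext fun i => ?_) (funext fun j => congrFun h (Sum.inr j))
  have := congrFun h (Sum.inl i)
  simp only [mult, Sum.elim_inl] at this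
  by_cases hp : i ∈ p.1 <;> by_cases hq : i ∈ q.1 <;> simp_all

theorem gdeg_eq_sum_mult (p : GIx m n) : gdeg p = ∑ x, mult p x := by
  simp [gdeg, mult]

theorem exists_mult_lt {p q : GIx m n} (h : gdeg p = gdeg q) (hne : p ≠ q) :
    ∃ x, mult p x < mult q x := by
  by_contra! hle
  rw [gdeg_eq_sum_mult, gdeg_eq_sum_mult] at h
  have := (Finset.sum_eq_sum_iff_of_le fun x _ => hle x).1 h.symm
  exact hne (mult_injective (funext fun x => (this x (Finset.mem_univ x)).symm))

theorem ann_fst_ne_zero {y : Fin m ⊕ Fin n} {p : GIx m n} :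
    (ann y p).1 ≠ 0 ↔ 0 < mult p y := by
  rcases y with j | j
  · by_cases hj : j ∈ p.1 <;> simp [ann, mult, hj, rsgn_ne_zero]
  · simp [ann, mult, Nat.pos_iff_ne_zero]

theorem mult_ann {y : Fin m ⊕ Fin n} {p : GIx m n} (h : 0 < mult p y) :
    mult (ann y p).2 + Pi.single y 1 = mult p := by
  funext z
  rcases y with j | j <;> rcases z with i | i
  · by_cases hj : j ∈ p.1
    · by_cases hij : i = j
      · subst hij; simp [ann, mult, hj]
      · simp [ann, mult, hij]
    · simp [mult, hj] at h
  · simp [ann, mult]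
  · rw [Pi.add_apply, Pi.single_eq_of_ne (by simp), add_zero]
    rfl
  · by_cases hij : i = j
    · subst hij
      simp only [mult, Sum.elim_inr] at h
      simp only [ann, mult, Pi.add_apply, Sum.elim_inr, Function.update_self, Pi.single_eq_same]
      omega
    · rw [Pi.add_apply, Pi.single_eq_of_ne (by simpa using hij), add_zero]
      exact Function.update_of_ne hij _ _

theorem mult_cre {x : Fin m ⊕ Fin n} {p : GIx m n} (h : (cre x p).1 ≠ 0) :
    mult (cre x p).2 = mult p + Pi.single x 1 := by
  funext z
  rcases x with j | j <;> rcases z with i | i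
  · by_cases hj : j ∈ p.1
    · simp [cre, hj] at h
    · by_cases hij : i = j
      · subst hij; simp [cre, mult, hj]
      · simp [cre, mult, hij]
  · simp [cre, mult]
  · rw [Pi.add_apply, Pi.single_eq_of_ne (by simp), add_zero]
    rfl
  · by_cases hij : i = j
    · subst hij; simp [cre, mult]
    · simp [cre, mult, hij]

theorem cre_fst_ne_zero {x : Fin m ⊕ Fin n} {p q : GIx m n} (h : mult p x < mult q x) :
    (cre x p).1 ≠ 0 := by
  rcases x with i | i
  · by_cases hi : i ∈ p.1
    · simp only [mult, Sum.elim_inl, hi, if_true] at h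
      split_ifs at h <;> omega
    · simp [cre, hi, rsgn_ne_zero]
  · simp [cre]

theorem gdeg_ann {y : Fin m ⊕ Fin n} {p : GIx m n} (h : 0 < mult p y) :
    gdeg (ann y p).2 + 1 = gdeg p := by
  rw [gdeg_eq_sum_mult p, ← mult_ann h]
  simp only [gdeg_eq_sum_mult, Pi.add_apply, Finset.sum_add_distrib, Finset.sum_pi_single',
    Finset.mem_univ, if_true]

theorem gdeg_cre {x : Fin m ⊕ Fin n} {p : GIx m n} (h : (cre x p).1 ≠ 0) :
    gdeg (cre x p).2 = gdeg p + 1 := by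
  rw [gdeg_eq_sum_mult, mult_cre h]
  simp only [gdeg_eq_sum_mult, Pi.add_apply, Finset.sum_add_distrib, Finset.sum_pi_single',
    Finset.mem_univ, if_true]

theorem omegaGl_E_single (x y : Fin m ⊕ Fin n) (p : GIx m n) (c : F) :
    (OmegaGl F m n).E (vidx x) (vidx y) (Finsupp.single p c)
      = (Finsupp.single (cre x (ann y p).2).2
          (((cre x (ann y p).2).1 : F) * (((ann y p).1 : F) * c)) : GIx m n →₀ F) := by
  change monOp F (eact m n (vidx x) (vidx y)) (Finsupp.single p c) = _
  simp only [monOp_eact, LinearMap.comp_apply, monOp_single]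

theorem omegaGl_E_self_single (x : Fin m ⊕ Fin n) (p : GIx m n) (c : F) :
    (OmegaGl F m n).E (vidx x) (vidx x) (Finsupp.single p c)
      = (Finsupp.single p ((mult p x : F) * c) : GIx m n →₀ F) := by
  change monOp F (eact m n (vidx x) (vidx x)) (Finsupp.single p c) = _
  rw [monOp_single]
  rcases x with i | i
  · by_cases hi : i ∈ p.1 <;> simp [eact, vidx, mult, hi]
  · rcases Nat.eq_zero_or_pos (p.2 i) with h | h
    · simp [eact, vidx, mult, h]
    · have : p.2 i - 1 + 1 = p.2 i := by omega
      simp [eact, vidx, mult, this]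

theorem monOp_eact_self_apply (x : Fin m ⊕ Fin n) (v : GIx m n →₀ F) (p : GIx m n) :
    monOp F (eact m n (vidx x) (vidx x)) v p = (mult p x : F) * v p := by
  induction v using Finsupp.induction_linear with
  | zero => simp
  | add f g hf hg => rw [map_add, Finsupp.add_apply, hf, hg, Finsupp.add_apply, mul_add]
  | single q c =>
    have h : monOp F (eact m n (vidx x) (vidx x)) (Finsupp.single q c)
        = Finsupp.single q ((mult q x : F) * c) := omegaGl_E_self_single x q c
    rw [h]
    by_cases hq : q = p
    · subst hq; simp only [Finsupp.single_eq_same]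
    · simp only [Finsupp.single_eq_of_ne' hq, mul_zero]

theorem omegaK_eq_supported (k : ℕ) :
    OmegaK F m n k = Finsupp.supported F F {p : GIx m n | gdeg p = k} := by
  rw [Finsupp.supported_eq_span_single, OmegaK]
  congr 1
  ext x
  simp [eq_comm]

theorem single_mem_omegaK {k : ℕ} {p : GIx m n} (hp : gdeg p = k) (c : F) :
    Finsupp.single p c ∈ OmegaK F m n k := by
  rw [omegaK_eq_supported]
  exact Finsupp.single_mem_supported F c hp

theorem glStable_omegaK (k : ℕ) : glStable (OmegaGl F m n) (OmegaK F m n k) := by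
  intro a b
  obtain ⟨x, rfl⟩ := vidx_surjective a
  obtain ⟨y, rfl⟩ := vidx_surjective b
  change OmegaK F m n k ≤ (OmegaK F m n k).comap ((OmegaGl F m n).E (vidx x) (vidx y))
  refine Submodule.span_le.2 ?_
  rintro _ ⟨p, hp, rfl⟩
  change (OmegaGl F m n).E (vidx x) (vidx y) (Finsupp.single p 1) ∈ OmegaK F m n k
  rw [omegaGl_E_single]
  by_cases hy : (ann y p).1 = 0
  · simp only [hy, Int.cast_zero, zero_mul, mul_zero, Finsupp.single_zero]
    exact Submodule.zero_mem _
  by_cases hx : (cre x (ann y p).2).1 = 0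
  · simp only [hx, Int.cast_zero, zero_mul, Finsupp.single_zero]
    exact Submodule.zero_mem _
  refine single_mem_omegaK ?_ _
  rw [gdeg_cre hx, gdeg_ann (ann_fst_ne_zero.1 hy), hp]

section
variable [CharZero F] {N : Submodule F (GIx m n →₀ F)} (hN : glStable (OmegaGl F m n) N)
include hN

theorem single_mem_of_glStable {v : GIx m n →₀ F} (hv : v ∈ N) {p : GIx m n} (hp : v p ≠ 0) :
    Finsupp.single p 1 ∈ N := by
  induction hd : v.support.card using Nat.strong_induction_on generalizing v with
  | _ d ih =>
    subst hd
    by_cases h : ∃ q, v q ≠ 0 ∧ q ≠ p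
    · obtain ⟨q, hq, hqp⟩ := h
      obtain ⟨x, hx⟩ : ∃ x, mult q x ≠ mult p x := by
        by_contra! h
        exact hqp (mult_injective (funext h))
      let w : GIx m n →₀ F := monOp F (eact m n (vidx x) (vidx x)) v
      have hw : ∀ r, (w - (mult q x : F) • v) r = ((mult r x : F) - mult q x) * v r := by
        intro r
        rw [Finsupp.sub_apply, monOp_eact_self_apply x v r, Finsupp.smul_apply, smul_eq_mul]
        ring
      refine ih _ ?_ (v := w - (mult q x : F) • v)
        (N.sub_mem (hN _ _ v hv) (N.smul_mem _ hv)) ?_ rfl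
      · refine Finset.card_lt_card ⟨fun r hr => ?_, fun hsub => ?_⟩
        · rw [Finsupp.mem_support_iff, hw] at hr
          exact Finsupp.mem_support_iff.2 (right_ne_zero_of_mul hr)
        · have := hsub (Finsupp.mem_support_iff.2 hq)
          rw [Finsupp.mem_support_iff, hw] at this
          simp at this
      · rw [hw]
        refine mul_ne_zero (sub_ne_zero.2 ?_) hp
        exact_mod_cast hx.symm
    · push Not at h
      have : Finsupp.single p 1 = (v p)⁻¹ • v := by
        ext r
        by_cases hr : r = p
        · subst hr; simp [hp]
        · have h0 : v r = 0 := by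
            by_contra h0
            exact hr (h r h0)
          simp [h0, Finsupp.single_eq_of_ne hr]
      rw [this]
      exact N.smul_mem _ hv

theorem single_mem_of_single_mem {p q : GIx m n} (hpq : gdeg p = gdeg q)
    (hp : Finsupp.single p 1 ∈ N) : Finsupp.single q 1 ∈ N := by
  induction hd : ∑ x, (mult p x - mult q x) using Nat.strong_induction_on generalizing p with
  | _ d ih =>
    subst hd
    by_cases hne : p = q
    · rwa [← hne]
    obtain ⟨x, hx⟩ := exists_mult_lt hpq hne
    obtain ⟨y, hy⟩ := exists_mult_lt hpq.symm (Ne.symm hne)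
    have hxy : x ≠ y := by
      rintro rfl
      exact hx.not_gt hy
    have hy0 : 0 < mult p y := by omega
    have ha := mult_ann hy0
    have hax : mult (ann y p).2 x = mult p x := by
      rw [← ha]; simp [hxy]
    have hc := cre_fst_ne_zero (p := (ann y p).2) (q := q) (hax ▸ hx)
    have hm : mult (cre x (ann y p).2).2 + Pi.single y 1 = mult p + Pi.single x 1 := by
      rw [mult_cre hc, ← ha, add_right_comm]
    have hmem := hN (vidx x) (vidx y) _ hp
    rw [omegaGl_E_single] at hmem
    refine ih _ ?_ (p := (cre x (ann y p).2).2) ?_ ?_ rfl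
    · refine Finset.sum_lt_sum (fun z _ => ?_) ⟨y, Finset.mem_univ y, ?_⟩
      · have := congrFun hm z
        simp only [Pi.add_apply, Pi.single_apply] at this
        split_ifs at this <;> subst_vars <;> omega
      · have := congrFun hm y
        simp only [Pi.add_apply, Pi.single_eq_same, Pi.single_eq_of_ne hxy.symm] at this
        omega
    · rw [gdeg_cre hc, gdeg_ann hy0, hpq]
    · refine single_mem_of_glStable hN hmem ?_
      rw [Finsupp.single_eq_same]
      have := ann_fst_ne_zero.2 hy0
      simp [hc, this]

theorem eq_bot_or_eq_omegaK {k : ℕ} (hle : N ≤ OmegaK F m n k) :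
    N = ⊥ ∨ N = OmegaK F m n k := by
  refine or_iff_not_imp_left.2 fun hbot => le_antisymm hle ?_
  obtain ⟨v, hv, hv0⟩ := N.ne_bot_iff.1 hbot
  obtain ⟨p, hp⟩ := Finsupp.ne_iff.1 hv0
  have hpk : gdeg p = k := by
    have := hle hv
    rw [omegaK_eq_supported, Finsupp.mem_supported] at this
    exact this (Finsupp.mem_support_iff.2 hp)
  refine Submodule.span_le.2 ?_
  rintro _ ⟨q, hq, rfl⟩
  exact single_mem_of_single_mem hN (hpk.trans hq.symm) (single_mem_of_glStable hN hv hp)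

end

/-! ## The highest weight vector -/

/-- The monomial `e₁ ∧ ⋯ ∧ e_k` if `k ≤ m`, and `e₁ ∧ ⋯ ∧ e_m ∧ e_{m+1}^{k-m}` if `k ≥ m`. -/
def hwMon (m : ℕ) {n : ℕ} (hn : 0 < n) (k : ℕ) : GIx m n :=
  (Finset.univ.filter fun i : Fin m => (i : ℕ) < k, Pi.single ⟨0, hn⟩ (k - m))

theorem gdeg_hwMon (hn : 0 < n) (k : ℕ) : gdeg (hwMon m hn k) = k := by
  have : (Finset.univ.filter fun i : Fin m => (i : ℕ) < k).card = min m k :=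
    Fin.card_filter_val_lt
  simp only [gdeg, hwMon, Finset.sum_pi_single', Finset.mem_univ, if_true, this]
  omega

theorem omegaw_fst (k : ℕ) (i : Fin m) :
    (omegaw F m n k).1 i = if (i : ℕ) < k then 1 else 0 := by
  simp [omegaw, eps1, del1, Prod.fst_sum]

theorem omegaw_snd (hn : 0 < n) (k : ℕ) (j : Fin n) :
    (omegaw F m n k).2 j = ((Pi.single (⟨0, hn⟩ : Fin n) (k - m) : Fin n → ℕ) j : F) := by
  simp [omegaw, eps1, del1, Prod.snd_sum, Pi.single_apply, Fin.ext_iff]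

theorem glWtVec_hwMon (hn : 0 < n) (k : ℕ) :
    glWtVec (OmegaGl F m n) (omegaw F m n k) (Finsupp.single (hwMon m hn k) (1 : F)) := by
  intro a
  obtain ⟨x, rfl⟩ := vidx_surjective a
  rw [omegaGl_E_self_single]
  change _ = coordw (omegaw F m n k) (vidx x) • Finsupp.single (hwMon m hn k) (1 : F)
  rw [Finsupp.smul_single, smul_eq_mul]
  congr 2
  rcases x with i | i
  · simp [coordw, vidx, omegaw_fst, mult, hwMon]
  · simp [coordw, vidx, omegaw_snd hn, mult, hwMon]

theorem glRaise_hwMon (hn : 0 < n) (k : ℕ) :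
    glRaise (OmegaGl F m n) (Finsupp.single (hwMon m hn k) (1 : F)) := by
  intro a b hab
  obtain ⟨x, rfl⟩ := vidx_surjective a
  obtain ⟨y, rfl⟩ := vidx_surjective b
  rw [omegaGl_E_single]
  suffices h : (cre x (ann y (hwMon m hn k)).2).1 = 0 ∨ (ann y (hwMon m hn k)).1 = 0 by
    rcases h with h | h <;> simp only [h, Int.cast_zero, zero_mul, mul_zero,
      Finsupp.single_zero] <;> rfl
  rw [Fin.lt_def] at hab
  rcases x with i | i <;> rcases y with j | j
  · simp only [vidx, finSumFinEquiv_apply_left, Fin.val_castAdd] at hab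
    by_cases hj : (j : ℕ) < k
    · left
      have : (i : ℕ) < k := by omega
      have hne : i ≠ j := by rintro rfl; omega
      simp [cre, ann, hwMon, this, hne]
    · right
      simp [ann, hwMon, hj]
  · by_cases hk : k ≤ m
    · right
      have : k - m = 0 := by omega
      simp [ann, hwMon, this]
    · left
      have : (i : ℕ) < k := by omega
      simp [cre, ann, hwMon, this]
  · simp only [vidx, finSumFinEquiv_apply_left, finSumFinEquiv_apply_right, Fin.val_castAdd,
      Fin.val_natAdd] at hab
    omega
  · right
    simp only [vidx, finSumFinEquiv_apply_right, Fin.val_natAdd] at hab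
    have : j ≠ ⟨0, hn⟩ := by rintro rfl; simp at hab
    simp [ann, hwMon, this]

end

end Wmn

/-- For every `k ∈ ℕ`, the `k`-th Grassmann power `Ω^k(V)` of
the natural `gl(m|n)`-module `V = F^{m|n}` is an irreducible `gl(m|n)`-module,
isomorphic to `L⁰(Λ)` with `Λ = ε₁+⋯+ε_k` for `k ≤ m` and
`Λ = ε₁+⋯+ε_m+(k−m)δ₁` for `k ≥ m` (i.e. `Λ = ω_k`): it is an irreducible
module with a highest weight vector of weight `ω_k`. -/
theorem statement7 (F : Type) [Field F] [IsAlgClosed F] [CharZero F]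
    (m n : ℕ) (hm : 0 < m) (hn : 0 < n) (k : ℕ) :
    IsGlRep (OmegaGl F m n)
    ∧ glStable (OmegaGl F m n) (OmegaK F m n k)
    ∧ OmegaK F m n k ≠ ⊥
    ∧ (∀ N : Submodule F (OmegaGl F m n).M, glStable (OmegaGl F m n) N →
        N ≤ OmegaK F m n k → N = ⊥ ∨ N = OmegaK F m n k)
    ∧ (∃ v ∈ OmegaK F m n k, v ≠ 0 ∧ glWtVec (OmegaGl F m n) (omegaw F m n k) v ∧
        glRaise (OmegaGl F m n) v) := by
  have hv : Finsupp.single (hwMon m hn k) (1 : F) ∈ OmegaK F m n k :=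
    single_mem_omegaK (gdeg_hwMon hn k) 1
  have hv0 : Finsupp.single (hwMon m hn k) (1 : F) ≠ 0 :=
    Finsupp.single_ne_zero.2 one_ne_zero
  refine ⟨isGlRep_omegaGl, glStable_omegaK k, ?_, fun N hN hle => eq_bot_or_eq_omegaK hN hle,
    Finsupp.single (hwMon m hn k) (1 : F), hv, hv0, glWtVec_hwMon hn k, glRaise_hwMon hn k⟩
  exact (Submodule.ne_bot_iff _).2 ⟨_, hv, hv0⟩
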